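/- For a real number B ≥ 6, let p_B denote the largest prime number p such that p · Π(p) ≤ B, where Π(p) = ∏_{q ≤ p, q prime} q is the primorial of p. Then p_B is asymptotic to log B, i.e., p_B / log B → 1 as B → ∞. -/

import Mathlib

/-- For a real `B`, `pB B` is the largest prime `p` such that `p · Π(p) ≤ B`, where
`Π(p)` is the primorial of `p` (the product of all primes `q ≤ p`). -/
noncomputable def pB (B : ℝ) : ℕ :=
  sSup {p : ℕ | p.Prime ∧ (p : ℝ) * (primorial p : ℝ) ≤ B}

open MeasureTheory Set Filter Topology Complex

/-- The Fejér kernel as the Fourier transform of a triangle function. -/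
theorem integral_triangle_mul_cexp (t : ℝ) :
    ∫ y in (-2 : ℝ)..2, ((2 - |y| : ℝ) : ℂ) * cexp (y * t * I) = 4 * (Real.sinc t : ℂ) ^ 2 := by
  have hi (a b : ℝ) : IntervalIntegrable
      (fun y : ℝ => ((2 - |y| : ℝ) : ℂ) * cexp (y * t * I)) volume a b :=
    Continuous.intervalIntegrable (by fun_prop) _ _
  rw [← intervalIntegral.integral_add_adjacent_intervals (hi (-2) 0) (hi 0 2)]
  have h1 : ∫ y in (-2 : ℝ)..0, ((2 - |y| : ℝ) : ℂ) * cexp (y * t * I)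
      = ∫ y in (-2 : ℝ)..0, (2 + (y : ℂ)) * cexp (y * t * I) := by
    refine intervalIntegral.integral_congr fun y hy => ?_
    rw [uIcc_of_le (by norm_num)] at hy
    simp [abs_of_nonpos hy.2]
  have h2 : ∫ y in (0 : ℝ)..2, ((2 - |y| : ℝ) : ℂ) * cexp (y * t * I)
      = ∫ y in (0 : ℝ)..2, (2 - (y : ℂ)) * cexp (y * t * I) := by
    refine intervalIntegral.integral_congr fun y hy => ?_
    rw [uIcc_of_le (by norm_num)] at hy
    simp [abs_of_nonneg hy.1]
  rw [h1, h2]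
  rcases eq_or_ne t 0 with rfl | ht
  · have h3 : ∫ y in (-2 : ℝ)..0, (2 + (y : ℂ)) = 2 := by
      have : ∀ y : ℝ, (2 + (y : ℂ)) = ((2 + y : ℝ) : ℂ) := by intro y; push_cast; ring
      simp_rw [this, intervalIntegral.integral_ofReal]
      rw [intervalIntegral.integral_add (Continuous.intervalIntegrable (by fun_prop) _ _)
        (Continuous.intervalIntegrable (by fun_prop) _ _)]
      norm_num
    have h4 : ∫ y in (0 : ℝ)..2, (2 - (y : ℂ)) = 2 := by
      have : ∀ y : ℝ, (2 - (y : ℂ)) = ((2 - y : ℝ) : ℂ) := by intro y; push_cast; ring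
      simp_rw [this, intervalIntegral.integral_ofReal]
      rw [intervalIntegral.integral_sub (Continuous.intervalIntegrable (by fun_prop) _ _)
        (Continuous.intervalIntegrable (by fun_prop) _ _)]
      norm_num
    simp [h3, h4]
    norm_num
  · have htc : (t : ℂ) ≠ 0 := by exact_mod_cast ht
    have hexp (y : ℝ) : HasDerivAt (fun y : ℝ => cexp (y * t * I))
        (cexp (y * t * I) * (t * I)) y := by
      have := (((ofRealCLM.hasDerivAt (x := y)).mul_const (t : ℂ)).mul_const I).cexp
      simpa using this
    have hid (y : ℝ) : HasDerivAt (fun y : ℝ => (y : ℂ)) 1 y := by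
      exact (hasDerivAt_id y).ofReal_comp
    have d1 (y : ℝ) : HasDerivAt
        (fun y : ℝ => (2 + (y : ℂ)) * cexp (y * t * I) / (t * I) + cexp (y * t * I) / t ^ 2)
        ((2 + (y : ℂ)) * cexp (y * t * I)) y := by
      have := ((((hid y).const_add 2).mul (hexp y)).div_const (t * I)).add
        ((hexp y).div_const ((t : ℂ) ^ 2))
      convert! this using 1
      field_simp
      linear_combination -I_sq
    have d2 (y : ℝ) : HasDerivAt
        (fun y : ℝ => (2 - (y : ℂ)) * cexp (y * t * I) / (t * I) - cexp (y * t * I) / t ^ 2)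
        ((2 - (y : ℂ)) * cexp (y * t * I)) y := by
      have := ((((hid y).const_sub 2).mul (hexp y)).div_const (t * I)).sub
        ((hexp y).div_const ((t : ℂ) ^ 2))
      convert! this using 1
      field_simp
      linear_combination I_sq
    rw [intervalIntegral.integral_eq_sub_of_hasDerivAt (fun y _ => d1 y)
        (Continuous.intervalIntegrable (by fun_prop) _ _),
      intervalIntegral.integral_eq_sub_of_hasDerivAt (fun y _ => d2 y)
        (Continuous.intervalIntegrable (by fun_prop) _ _), Real.sinc_of_ne_zero ht]
    have e1 : cexp ((2 : ℝ) * t * I) = cexp (t * I) ^ 2 := by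
      rw [← Complex.exp_nat_mul]; congr 1; push_cast; ring
    have e2 : cexp ((-2 : ℝ) * t * I) = cexp (-t * I) ^ 2 := by
      rw [← Complex.exp_nat_mul]; congr 1; push_cast; ring
    have e3 : cexp (t * I) * cexp (-t * I) = 1 := by rw [← Complex.exp_add]; simp
    rw [e1, e2]
    push_cast
    rw [Complex.sin]
    simp
    field_simp
    simp
    rw [neg_mul] at e3
    linear_combination (-8 * I) * e3

theorem integrable_sinc_sq : Integrable (fun t : ℝ => Real.sinc t ^ 2) := by
  refine (integrable_inv_one_add_sq.const_mul 2).mono'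
    (by fun_prop) (ae_of_all _ fun t => ?_)
  rw [Real.norm_of_nonneg (sq_nonneg _), ← div_eq_mul_inv, le_div_iff₀ (by positivity)]
  have h1 : Real.sinc t ^ 2 ≤ 1 := by
    rw [sq_le_one_iff_abs_le_one]; exact Real.abs_sinc_le_one t
  have h2 : Real.sinc t ^ 2 * t ^ 2 ≤ 1 := by
    rcases eq_or_ne t 0 with rfl | ht
    · simp
    · rw [Real.sinc_of_ne_zero ht, div_pow, div_mul_cancel₀ _ (by positivity)]
      exact Real.sin_sq_le_one t
  linarith

theorem integral_cexp_mul_sinc_sq {a : ℝ → ℝ} {C : ℝ} (ham : Measurable a)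
    (hC : ∀ t, 0 < t → |a t| ≤ C) {ε : ℝ} (hε : 0 < ε) (u : ℝ) :
    ∫ t in Ioi (0 : ℝ), (a t : ℂ) * cexp (-ε * t) * (4 * (Real.sinc (u - t) : ℂ) ^ 2) =
      ∫ y in (-2 : ℝ)..2, ((2 - |y| : ℝ) : ℂ) * cexp (y * u * I) *
        ∫ t in Ioi (0 : ℝ), (a t : ℂ) * cexp (-(ε + y * I) * t) := by
  rw [intervalIntegral.integral_of_le (by norm_num)]
  simp_rw [← integral_triangle_mul_cexp, intervalIntegral.integral_of_le
    (show (-2 : ℝ) ≤ 2 by norm_num), ← integral_const_mul]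
  rw [integral_integral_swap]
  · refine integral_congr_ae (ae_of_all _ fun y => integral_congr_ae (ae_of_all _ fun t => ?_))
    have h1 : cexp (y * (u - t : ℝ) * I) = cexp (y * u * I) * cexp (-(y * I * t)) := by
      rw [← Complex.exp_add]; congr 1; push_cast; ring
    have h2 : cexp (-(ε + y * I) * t) = cexp (-ε * t) * cexp (-(y * I * t)) := by
      rw [← Complex.exp_add]; congr 1; ring
    simp only [h1, h2]
    ring
  · have h1 : Integrable (fun t : ℝ => (a t : ℂ) * cexp (-ε * t)) (volume.restrict (Ioi 0)) := by
      refine (integrableOn_exp_mul_complex_Ioi (a := -ε) (by simpa) 0).bdd_mul (c := C)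
        (by fun_prop) ?_
      filter_upwards [ae_restrict_mem measurableSet_Ioi] with t ht
      simpa using hC t ht
    have h2 : Integrable (fun y : ℝ => ((2 - |y| : ℝ) : ℂ)) (volume.restrict (Ioc (-2) 2)) :=
      (Continuous.integrableOn_Icc (by fun_prop)).mono_set Ioc_subset_Icc_self
    refine ((h1.mul_prod h2).bdd_mul (c := 1)
      (f := fun z : ℝ × ℝ => cexp (z.2 * (u - z.1 : ℝ) * I))
      (Continuous.aestronglyMeasurable (by fun_prop)) (ae_of_all _ fun z => ?_)).congr
      (ae_of_all _ fun z => ?_)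
    · rw [← ofReal_mul, norm_exp_ofReal_mul_I]
    · simp only [Function.uncurry]; ring

/-- The Riemann-Lebesgue lemma on a bounded interval. -/
theorem tendsto_integral_mul_cexp_atTop {f : ℝ → ℂ} (a b : ℝ) (hab : a ≤ b) :
    Tendsto (fun u : ℝ => ∫ y in a..b, f y * cexp (y * u * I)) atTop (𝓝 0) := by
  have h := (Real.tendsto_integral_exp_smul_cocompact (indicator (Ioc a b) f)).comp
    ((tendsto_id.atTop_mul_const_of_neg (show -(2 * Real.pi)⁻¹ < 0 by
      have := Real.pi_pos; simp; positivity)).mono_right atBot_le_cocompact)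
  refine h.congr fun u => ?_
  rw [intervalIntegral.integral_of_le hab, ← integral_indicator measurableSet_Ioc]
  refine integral_congr_ae (ae_of_all _ fun y => ?_)
  by_cases hy : y ∈ Ioc a b
  · simp only [indicator_of_mem hy, Real.fourierChar_apply, Circle.smul_def, smul_eq_mul, id]
    rw [mul_comm]
    congr 2
    push_cast
    have : (Real.pi : ℂ) ≠ 0 := by exact_mod_cast Real.pi_ne_zero
    field_simp
  · simp [indicator_of_notMem hy]

/-- If the Laplace transform of a bounded function extends continuously to the closed right
half-plane, then the convolution of the function with the Fejér kernel tends to zero. -/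
theorem tendsto_integral_mul_sinc_sq {a : ℝ → ℝ} {C : ℝ} (ham : Measurable a)
    (hC : ∀ t, 0 < t → |a t| ≤ C) {G : ℂ → ℂ} (hG : ContinuousOn G {s | 0 ≤ s.re})
    (hL : ∀ s : ℂ, 0 < s.re → ∫ t in Ioi (0 : ℝ), (a t : ℂ) * cexp (-s * t) = G s) :
    Tendsto (fun u => ∫ t in Ioi (0 : ℝ), a t * Real.sinc (u - t) ^ 2) atTop (𝓝 0) := by
  have key (u : ℝ) : ∫ t in Ioi (0 : ℝ), (a t : ℂ) * (4 * (Real.sinc (u - t) : ℂ) ^ 2) =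
      ∫ y in (-2 : ℝ)..2, ((2 - |y| : ℝ) : ℂ) * cexp (y * u * I) * G (y * I) := by
    have hK : Integrable (fun t : ℝ => Real.sinc (u - t) ^ 2) :=
      integrable_sinc_sq.comp_sub_left u
    have l1 : Tendsto (fun ε : ℝ => ∫ t in Ioi (0 : ℝ), (a t : ℂ) * cexp (-ε * t) *
        (4 * (Real.sinc (u - t) : ℂ) ^ 2)) (𝓝[>] 0)
        (𝓝 (∫ t in Ioi (0 : ℝ), (a t : ℂ) * (4 * (Real.sinc (u - t) : ℂ) ^ 2))) := by
      refine tendsto_integral_filter_of_dominated_convergence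
        (fun t => C * (4 * Real.sinc (u - t) ^ 2))
        (Eventually.of_forall fun ε => by fun_prop) ?_
        ((hK.const_mul 4).const_mul C).integrableOn (ae_of_all _ fun t => ?_)
      · filter_upwards [self_mem_nhdsWithin] with ε hε
        filter_upwards [ae_restrict_mem measurableSet_Ioi] with t ht
        have h1 : ‖cexp (-ε * t)‖ ≤ 1 := by
          rw [Complex.norm_exp]
          simp only [Real.exp_le_one_iff]
          have : 0 < ε * t := mul_pos hε ht
          simpa using this.le
        have h2 : ‖(4 * (Real.sinc (u - t) : ℂ) ^ 2)‖ = 4 * Real.sinc (u - t) ^ 2 := by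
          simp
        rw [norm_mul, norm_mul, h2, norm_real, Real.norm_eq_abs]
        have := hC t ht
        have h0 := abs_nonneg (a t)
        gcongr
        nlinarith [norm_nonneg (cexp (-ε * t))]
      · have : ContinuousAt (fun ε : ℝ => (a t : ℂ) * cexp (-ε * t) *
          (4 * (Real.sinc (u - t) : ℂ) ^ 2)) 0 := by fun_prop
        have := this.tendsto
        simp only [ofReal_zero, neg_zero, zero_mul, Complex.exp_zero, mul_one] at this
        exact this.mono_left nhdsWithin_le_nhds
    have l2 : Tendsto (fun ε : ℝ => ∫ y in (-2 : ℝ)..2, ((2 - |y| : ℝ) : ℂ) * cexp (y * u * I) *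
        G (ε + y * I)) (𝓝[>] 0)
        (𝓝 (∫ y in (-2 : ℝ)..2, ((2 - |y| : ℝ) : ℂ) * cexp (y * u * I) * G (y * I))) := by
      have hcont : ContinuousOn (fun p : ℝ × ℝ => ((2 - |p.2| : ℝ) : ℂ) * cexp (p.2 * u * I) *
          G (p.1 + p.2 * I)) (Icc 0 1 ×ˢ Icc (-2) 2) := by
        refine ContinuousOn.mul (by fun_prop) (hG.comp (by fun_prop) ?_)
        rintro ⟨ε, y⟩ ⟨h, -⟩
        simpa using h.1
      obtain ⟨M, hM⟩ := (isCompact_Icc.prod isCompact_Icc).exists_bound_of_continuousOn hcont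
      have hev : ∀ᶠ ε : ℝ in 𝓝[>] 0, ε ∈ Icc (0 : ℝ) 1 := by
        filter_upwards [Ioo_mem_nhdsGT (show (0 : ℝ) < 1 by norm_num)] with ε hε
        exact ⟨hε.1.le, hε.2.le⟩
      simp_rw [intervalIntegral.integral_of_le (show (-2 : ℝ) ≤ 2 by norm_num)]
      refine tendsto_integral_filter_of_dominated_convergence (fun _ => M) ?_ ?_
        (integrable_const _) ?_
      · filter_upwards [hev] with ε hε
        refine ContinuousOn.aestronglyMeasurable ?_ measurableSet_Ioc
        exact hcont.comp (f := fun y : ℝ => (ε, y)) (by fun_prop)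
          fun y hy => ⟨hε, Ioc_subset_Icc_self hy⟩
      · filter_upwards [hev] with ε hε
        filter_upwards [ae_restrict_mem measurableSet_Ioc] with y hy
        exact hM (ε, y) ⟨hε, Ioc_subset_Icc_self hy⟩
      · filter_upwards [ae_restrict_mem measurableSet_Ioc] with y hy
        have h0 := (hcont (0, y) ⟨by simp, Ioc_subset_Icc_self hy⟩).tendsto
        simp only [ofReal_zero, zero_add] at h0
        refine h0.comp (f := fun ε : ℝ => (ε, y)) (tendsto_nhdsWithin_iff.2 ⟨?_, ?_⟩)
        · exact ((by fun_prop : Continuous fun ε : ℝ => (ε, y)).tendsto 0).mono_left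
            nhdsWithin_le_nhds
        · filter_upwards [hev] with ε hε
          exact ⟨hε, Ioc_subset_Icc_self hy⟩
    refine tendsto_nhds_unique (l1.congr' ?_) l2
    filter_upwards [self_mem_nhdsWithin] with ε hε
    rw [integral_cexp_mul_sinc_sq ham hC hε]
    refine intervalIntegral.integral_congr fun y _ => ?_
    rw [hL _ (by simpa using hε)]
  have h4 : Tendsto (fun u => ∫ t in Ioi (0 : ℝ), (a t : ℂ) * (4 * (Real.sinc (u - t) : ℂ) ^ 2))
      atTop (𝓝 0) := by
    simp_rw [key]
    refine (tendsto_integral_mul_cexp_atTop (f := fun y => ((2 - |y| : ℝ) : ℂ) * G (y * I))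
      (-2) 2 (by norm_num)).congr fun u => ?_
    refine intervalIntegral.integral_congr fun y _ => ?_
    ring
  have h5 := (Complex.continuous_re.tendsto _).comp (h4.div_const 4)
  simp only [zero_div, zero_re] at h5
  refine h5.congr fun u => ?_
  simp only [Function.comp]
  rw [← integral_div, ← ofReal_re (∫ t in Ioi (0 : ℝ), a t * Real.sinc (u - t) ^ 2),
    ← integral_complex_ofReal]
  congr 2
  ext t
  push_cast
  ring

theorem tendsto_integral_Ioi_comp_sub_left {f : ℝ → ℝ} (hf : Integrable f) :
    Tendsto (fun u => ∫ t in Ioi (0 : ℝ), f (u - t)) atTop (𝓝 (∫ t, f t)) := by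
  refine ((aecover_Iio (μ := volume) tendsto_id).integral_tendsto_of_countably_generated hf).congr
    fun u => ?_
  simp only [id]
  rw [← integral_indicator measurableSet_Iio, ← integral_indicator measurableSet_Ioi,
    ← integral_sub_left_eq_self _ volume u]
  congr 1
  ext t
  simp [indicator_apply]

theorem integral_sinc_sq_pos : 0 < ∫ t, Real.sinc t ^ 2 :=
  integral_pos_of_integrable_nonneg_nonzero (x := 0) (by fun_prop) integrable_sinc_sq
    (fun t => sq_nonneg _) (by simp)

theorem tendsto_integral_dilation_mul_sinc_sq {b : ℝ → ℝ} {C : ℝ} (hbm : Measurable b)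
    (hC : ∀ t, 0 < t → |b t| ≤ C) {G : ℂ → ℂ} (hG : ContinuousOn G {s | 0 ≤ s.re})
    (hL : ∀ s : ℂ, 0 < s.re → ∫ t in Ioi (0 : ℝ), ((b t - 1 : ℝ) : ℂ) * cexp (-s * t) = G s)
    {L : ℝ} (hLpos : 0 < L) :
    Tendsto (fun u => ∫ t in Ioi (0 : ℝ), b (t / L) * Real.sinc (u - t) ^ 2) atTop
      (𝓝 (∫ t, Real.sinc t ^ 2)) := by
  have hc : ∀ t, 0 < t → |b (t / L) - 1| ≤ C + 1 := fun t ht => by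
    have := hC (t / L) (by positivity)
    rw [abs_le] at this ⊢
    constructor <;> linarith
  have h1 : Tendsto (fun u => ∫ t in Ioi (0 : ℝ), (b (t / L) - 1) * Real.sinc (u - t) ^ 2)
      atTop (𝓝 0) := by
    refine tendsto_integral_mul_sinc_sq (a := fun t => b (t / L) - 1) (by fun_prop) hc
      (G := fun s => L * G (L * s)) ?_ ?_
    · refine continuousOn_const.mul (hG.comp (by fun_prop) fun s hs => ?_)
      simpa using mul_nonneg hLpos.le hs
    · intro s hs
      have := integral_comp_mul_left_Ioi
        (fun t => ((b (t / L) - 1 : ℝ) : ℂ) * cexp (-s * t)) 0 hLpos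
      rw [mul_zero] at this
      rw [← hL _ (by simpa using mul_pos hLpos hs)]
      have h2 : ∫ t in Ioi (0 : ℝ), ((b t - 1 : ℝ) : ℂ) * cexp (-(L * s) * t) =
          ∫ x in Ioi (0 : ℝ), ((b (L * x / L) - 1 : ℝ) : ℂ) * cexp (-s * (L * x : ℝ)) := by
        refine integral_congr_ae (ae_of_all _ fun t => ?_)
        simp only
        rw [mul_div_cancel_left₀ _ hLpos.ne']
        congr 2
        push_cast
        ring
      rw [h2, this, Complex.real_smul]
      push_cast
      rw [mul_inv_cancel_left₀ (by exact_mod_cast hLpos.ne')]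
  have h2 := h1.add (tendsto_integral_Ioi_comp_sub_left integrable_sinc_sq)
  rw [zero_add] at h2
  refine h2.congr fun u => ?_
  have hK : Integrable (fun t : ℝ => Real.sinc (u - t) ^ 2) (volume.restrict (Ioi 0)) :=
    (integrable_sinc_sq.comp_sub_left u).integrableOn
  rw [← integral_add _ hK]
  · refine integral_congr_ae (ae_of_all _ fun t => ?_)
    ring
  · refine hK.bdd_mul (c := C + 1) (Measurable.aestronglyMeasurable (by fun_prop)) ?_
    filter_upwards [ae_restrict_mem measurableSet_Ioi] with t ht
    exact hc t ht

theorem setIntegral_Ioc_sinc_sq_comp_sub_left (u M : ℝ) (hM : 0 ≤ M) :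
    ∫ t in Ioc (u - M) (u + M), Real.sinc (u - t) ^ 2 = ∫ t in -M..M, Real.sinc t ^ 2 := by
  rw [← intervalIntegral.integral_of_le (by linarith),
    intervalIntegral.integral_comp_sub_left (fun t => Real.sinc t ^ 2)]
  congr 1 <;> ring

theorem mul_le_integral_mul_sinc_sq {f : ℝ → ℝ} {C c u M : ℝ} (hfm : Measurable f)
    (hf : ∀ t, 0 < t → 0 ≤ f t) (hC : ∀ t, 0 < t → f t ≤ C) (hM : 0 ≤ M) (hu : M ≤ u)
    (hc : ∀ t ∈ Ioc (u - M) (u + M), c ≤ f t) :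
    c * ∫ t in -M..M, Real.sinc t ^ 2 ≤ ∫ t in Ioi (0 : ℝ), f t * Real.sinc (u - t) ^ 2 := by
  have hK : Integrable (fun t : ℝ => Real.sinc (u - t) ^ 2) :=
    integrable_sinc_sq.comp_sub_left u
  have hsub : Ioc (u - M) (u + M) ⊆ Ioi 0 := fun t ht => lt_of_le_of_lt (by linarith) ht.1
  have hfK : IntegrableOn (fun t => f t * Real.sinc (u - t) ^ 2) (Ioi 0) := by
    refine hK.integrableOn.bdd_mul (c := C) (by fun_prop) ?_
    filter_upwards [ae_restrict_mem measurableSet_Ioi] with t ht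
    rw [Real.norm_of_nonneg (hf t ht)]
    exact hC t ht
  rw [← setIntegral_Ioc_sinc_sq_comp_sub_left u M hM, ← integral_const_mul]
  calc _ ≤ ∫ t in Ioc (u - M) (u + M), f t * Real.sinc (u - t) ^ 2 := by
        refine setIntegral_mono_on (hK.const_mul c).integrableOn (hfK.mono_set hsub)
          measurableSet_Ioc fun t ht => ?_
        have := hc t ht
        gcongr
    _ ≤ _ := by
        refine setIntegral_mono_set hfK ?_ hsub.eventuallyLE
        filter_upwards [ae_restrict_mem measurableSet_Ioi] with t ht
        exact mul_nonneg (hf t ht) (sq_nonneg _)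

theorem integral_mul_sinc_sq_le {f : ℝ → ℝ} {C c u M : ℝ} (hfm : Measurable f)
    (hf : ∀ t, 0 < t → 0 ≤ f t) (hC : ∀ t, 0 < t → f t ≤ C) (hC0 : 0 ≤ C) (hM : 0 ≤ M)
    (hc0 : 0 ≤ c) (hc : ∀ t ∈ Ioc (u - M) (u + M), 0 < t → f t ≤ c) :
    ∫ t in Ioi (0 : ℝ), f t * Real.sinc (u - t) ^ 2 ≤
      c * (∫ t, Real.sinc t ^ 2) +
        C * ((∫ t, Real.sinc t ^ 2) - ∫ t in -M..M, Real.sinc t ^ 2) := by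
  have hK : Integrable (fun t : ℝ => Real.sinc (u - t) ^ 2) :=
    integrable_sinc_sq.comp_sub_left u
  have hfK : IntegrableOn (fun t => f t * Real.sinc (u - t) ^ 2) (Ioi 0) := by
    refine hK.integrableOn.bdd_mul (c := C) (by fun_prop) ?_
    filter_upwards [ae_restrict_mem measurableSet_Ioi] with t ht
    rw [Real.norm_of_nonneg (hf t ht)]
    exact hC t ht
  have hKi := hK.indicator (measurableSet_Ioc (a := u - M) (b := u + M))
  have hKd : Integrable (fun t => Real.sinc (u - t) ^ 2 -
      indicator (Ioc (u - M) (u + M)) (fun t => Real.sinc (u - t) ^ 2) t) := hK.sub hKi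
  have hg : Integrable (fun t => c * Real.sinc (u - t) ^ 2 + C * (Real.sinc (u - t) ^ 2 -
      indicator (Ioc (u - M) (u + M)) (fun t => Real.sinc (u - t) ^ 2) t)) :=
    (hK.const_mul c).add (hKd.const_mul C)
  have hnn (t : ℝ) : 0 ≤ Real.sinc (u - t) ^ 2 -
      indicator (Ioc (u - M) (u + M)) (fun t => Real.sinc (u - t) ^ 2) t := by
    by_cases h : t ∈ Ioc (u - M) (u + M)
    · simp [indicator_of_mem h]
    · simp [indicator_of_notMem h, sq_nonneg]
  calc _ ≤ ∫ t in Ioi (0 : ℝ), (c * Real.sinc (u - t) ^ 2 + C * (Real.sinc (u - t) ^ 2 -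
          indicator (Ioc (u - M) (u + M)) (fun t => Real.sinc (u - t) ^ 2) t)) := by
        refine setIntegral_mono_on hfK hg.integrableOn measurableSet_Ioi fun t ht => ?_
        have hs := sq_nonneg (Real.sinc (u - t))
        by_cases h : t ∈ Ioc (u - M) (u + M)
        · simp only [indicator_of_mem h, sub_self, mul_zero, add_zero]
          exact mul_le_mul_of_nonneg_right (hc t h ht) hs
        · simp only [indicator_of_notMem h, sub_zero]
          have := mul_le_mul_of_nonneg_right (hC t ht) hs
          nlinarith [mul_nonneg hc0 hs]
    _ ≤ ∫ t, (c * Real.sinc (u - t) ^ 2 + C * (Real.sinc (u - t) ^ 2 -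
          indicator (Ioc (u - M) (u + M)) (fun t => Real.sinc (u - t) ^ 2) t)) := by
        refine setIntegral_le_integral hg (ae_of_all _ fun t => ?_)
        exact add_nonneg (mul_nonneg hc0 (sq_nonneg _)) (mul_nonneg hC0 (hnn t))
    _ = _ := by
        rw [integral_add (hK.const_mul c) (hKd.const_mul C), integral_const_mul,
          integral_const_mul, integral_sub hK hKi, integral_indicator measurableSet_Ioc,
          setIntegral_Ioc_sinc_sq_comp_sub_left u M hM,
          integral_sub_left_eq_self (fun t => Real.sinc t ^ 2) volume u]

/-- A Wiener-Ikehara Tauberian theorem. -/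
theorem tendsto_one_of_laplace_continuousOn {b : ℝ → ℝ} {C : ℝ} (hbm : Measurable b)
    (hb : ∀ t, 0 < t → 0 ≤ b t) (hC : ∀ t, 0 < t → b t ≤ C)
    (hmono : ∀ s t, 0 < s → s ≤ t → b s * Real.exp (-(t - s)) ≤ b t)
    {G : ℂ → ℂ} (hG : ContinuousOn G {s | 0 ≤ s.re})
    (hL : ∀ s : ℂ, 0 < s.re → ∫ t in Ioi (0 : ℝ), ((b t - 1 : ℝ) : ℂ) * cexp (-s * t) = G s) :
    Tendsto b atTop (𝓝 1) := by
  have hC0 : 0 ≤ C := (hb 1 one_pos).trans (hC 1 one_pos)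
  set J := ∫ t, Real.sinc t ^ 2 with hJ
  have hJpos : 0 < J := integral_sinc_sq_pos
  have key : ∀ η ∈ Ioo (0 : ℝ) 1, ∀ᶠ x in atTop,
      (1 - η) * (1 - η - C * η) ≤ b x ∧ b x ≤ (1 + η) / (1 - η) ^ 2 := by
    rintro η ⟨hη, hη1⟩
    have h1η : 0 < 1 - η := by linarith
    have hJM := intervalIntegral_tendsto_integral integrable_sinc_sq tendsto_neg_atTop_atBot
      tendsto_id
    obtain ⟨M, hMlt, hM⟩ := ((hJM.eventually_const_lt (show (1 - η) * J < J by nlinarith)).and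
      (eventually_gt_atTop 0)).exists
    simp only [id] at hMlt
    set JM := ∫ t in -M..M, Real.sinc t ^ 2
    set L := 2 * M / η with hLdef
    have hLpos : 0 < L := by positivity
    have hexp : ∀ s t, 0 < s → s ≤ t → t ≤ s + 2 * M → b (s / L) * (1 - η) ≤ b (t / L) := by
      intro s t hs hst ht
      refine le_trans ?_ (hmono (s / L) (t / L) (by positivity) (by gcongr))
      refine mul_le_mul_of_nonneg_left ?_ (hb _ (by positivity))
      refine le_trans ?_ (Real.add_one_le_exp _)
      have : t / L - s / L ≤ η := by
        rw [← sub_div, div_le_iff₀ hLpos, hLdef, mul_div_cancel₀ _ hη.ne']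
        linarith
      linarith
    have hH := tendsto_integral_dilation_mul_sinc_sq hbm
      (fun t ht => by rw [abs_of_nonneg (hb t ht)]; exact hC t ht) hG hL hLpos
    have hlo := hH.eventually_const_lt (show (1 - η) * J < J by nlinarith)
    have hhi := hH.eventually_lt_const (show J < (1 + η) * J by nlinarith)
    have hbL : Measurable fun t => b (t / L) := by fun_prop
    have hbL0 : ∀ t, 0 < t → 0 ≤ b (t / L) := fun t ht => hb _ (by positivity)
    have hbLC : ∀ t, 0 < t → b (t / L) ≤ C := fun t ht => hC _ (by positivity)
    have t1 : Tendsto (fun x : ℝ => L * x - M) atTop atTop :=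
      tendsto_atTop_add_const_right _ _ (tendsto_id.const_mul_atTop hLpos)
    have t2 : Tendsto (fun x : ℝ => L * x + M) atTop atTop :=
      tendsto_atTop_add_const_right _ _ (tendsto_id.const_mul_atTop hLpos)
    filter_upwards [t1.eventually hlo, t2.eventually hhi, eventually_gt_atTop 0] with x h1 h2 hx
    have hxL : 0 < L * x := by positivity
    have hxx : L * x / L = x := mul_div_cancel_left₀ _ hLpos.ne'
    have hbx := hb x hx
    constructor
    · have h3 := integral_mul_sinc_sq_le (u := L * x - M) (c := b x / (1 - η)) hbL hbL0 hbLC hC0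
        hM.le (by positivity) (fun t ht ht0 => by
          rw [le_div_iff₀ h1η]
          simpa [hxx] using hexp t (L * x) ht0 (by linarith [ht.2]) (by linarith [ht.1]))
      have h4 : (1 - η - C * η) * J < b x / (1 - η) * J := by
        nlinarith [mul_le_mul_of_nonneg_left hMlt.le hC0]
      have h5 := lt_of_mul_lt_mul_right h4 hJpos.le
      rw [lt_div_iff₀ h1η] at h5
      linarith
    · have h3 := mul_le_integral_mul_sinc_sq (u := L * x + M) (c := b x * (1 - η)) hbL hbL0 hbLC
        hM.le (by linarith) (fun t ht => by
          simpa [hxx] using hexp (L * x) t hxL (by linarith [ht.1]) (by linarith [ht.2]))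
      rw [le_div_iff₀ (by positivity)]
      have h4 : b x * (1 - η) ^ 2 * J < (1 + η) * J := by
        have : 0 ≤ b x * (1 - η) := by positivity
        nlinarith [mul_le_mul_of_nonneg_left hMlt.le this]
      exact (lt_of_mul_lt_mul_right h4 hJpos.le).le
  have c1 : Tendsto (fun η : ℝ => (1 - η) * (1 - η - C * η)) (𝓝[>] 0) (𝓝 1) := by
    have : ContinuousAt (fun η : ℝ => (1 - η) * (1 - η - C * η)) 0 := by fun_prop
    simpa using this.tendsto.mono_left nhdsWithin_le_nhds
  have c2 : Tendsto (fun η : ℝ => (1 + η) / (1 - η) ^ 2) (𝓝[>] 0) (𝓝 1) := by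
    have : ContinuousAt (fun η : ℝ => (1 + η) / (1 - η) ^ 2) 0 :=
      ContinuousAt.div (by fun_prop) (by fun_prop) (by norm_num)
    simpa using this.tendsto.mono_left nhdsWithin_le_nhds
  have hev : ∀ᶠ η : ℝ in 𝓝[>] 0, η ∈ Ioo (0 : ℝ) 1 := Ioo_mem_nhdsGT one_pos
  refine tendsto_order.2 ⟨fun r hr => ?_, fun r hr => ?_⟩
  · obtain ⟨η, h1, h2⟩ := ((c1.eventually_const_lt hr).and hev).exists
    filter_upwards [key η h2] with x hx
    exact h1.trans_le hx.1
  · obtain ⟨η, h1, h2⟩ := ((c2.eventually_lt_const hr).and hev).exists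
    filter_upwards [key η h2] with x hx
    exact hx.2.trans_lt h1

open ArithmeticFunction in
theorem integral_psi_mul_cpow {s : ℂ} (hs : 1 < s.re) :
    ∫ x in Ioi (1 : ℝ), (Chebyshev.psi x : ℂ) * (x : ℂ) ^ (-(s + 1)) =
      LSeries (fun n => (vonMangoldt n : ℂ)) s / s := by
  have hs0 : s ≠ 0 := ne_zero_of_one_lt_re hs
  have hO : (fun n : ℕ => ∑ k ∈ Finset.Icc 1 n, vonMangoldt k) =O[atTop]
      fun n : ℕ => (n : ℝ) ^ (1 : ℝ) := by
    refine Asymptotics.IsBigO.of_bound (Real.log 4 + 4) (Eventually.of_forall fun n => ?_)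
    have h := Chebyshev.psi_le_const_mul_self (Nat.cast_nonneg (α := ℝ) n)
    have h0 := Chebyshev.psi_nonneg (n : ℝ)
    rw [Chebyshev.psi, Nat.floor_natCast, ← Finset.Icc_add_one_left_eq_Ioc, zero_add] at h h0
    rwa [Real.rpow_one, Real.norm_of_nonneg h0, Real.norm_of_nonneg (Nat.cast_nonneg n)]
  rw [LSeries_eq_mul_integral_of_nonneg (fun n => vonMangoldt n) zero_le_one hs hO
    (fun n => vonMangoldt_nonneg), mul_div_cancel_left₀ _ hs0]
  refine integral_congr_ae (ae_of_all _ fun x => ?_)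
  simp only [Chebyshev.psi, ← Finset.Icc_add_one_left_eq_Ioc, zero_add, ofReal_sum]

theorem image_exp_Ioi_zero : Real.exp '' Ioi 0 = Ioi 1 := by
  ext x
  constructor
  · rintro ⟨t, ht, rfl⟩
    exact Real.one_lt_exp_iff.2 ht
  · intro hx
    exact ⟨Real.log x, Real.log_pos hx, Real.exp_log (one_pos.trans hx)⟩

theorem integral_psi_exp_mul_cexp {s : ℂ} (hs : 0 < s.re) :
    ∫ t in Ioi (0 : ℝ), ((Chebyshev.psi (Real.exp t) / Real.exp t : ℝ) : ℂ) * cexp (-s * t) =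
      LSeries (fun n => (ArithmeticFunction.vonMangoldt n : ℂ)) (s + 1) / (s + 1) := by
  rw [← integral_psi_mul_cpow (by simpa using hs), ← image_exp_Ioi_zero,
    integral_image_eq_integral_abs_deriv_smul measurableSet_Ioi
      (fun x _ => (Real.hasDerivAt_exp x).hasDerivWithinAt) Real.exp_injective.injOn]
  refine integral_congr_ae (ae_of_all _ fun t => ?_)
  have h0 : cexp t ≠ 0 := Complex.exp_ne_zero _
  have h1 : (cexp t) ^ (-(s + 1 + 1)) = cexp (-s * t) * (cexp t)⁻¹ * (cexp t)⁻¹ := by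
    rw [← Complex.exp_neg, ← Complex.exp_add, ← Complex.exp_add, cpow_def_of_ne_zero h0,
      ← ofReal_exp, ← ofReal_log (Real.exp_pos t).le, Real.log_exp]
    congr 1
    ring
  simp only [abs_of_pos (Real.exp_pos t), Complex.real_smul, ofReal_exp, ofReal_div, h1]
  field_simp

theorem psi_exp_div_exp_le (t : ℝ) : Chebyshev.psi (Real.exp t) / Real.exp t ≤ Real.log 4 + 4 := by
  rw [div_le_iff₀ (Real.exp_pos t)]
  exact Chebyshev.psi_le_const_mul_self (Real.exp_pos t).le

theorem psi_exp_div_exp_nonneg (t : ℝ) : 0 ≤ Chebyshev.psi (Real.exp t) / Real.exp t :=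
  div_nonneg (Chebyshev.psi_nonneg _) (Real.exp_pos t).le

theorem measurable_psi_exp_div_exp :
    Measurable fun t => Chebyshev.psi (Real.exp t) / Real.exp t :=
  (Chebyshev.psi_mono.measurable.comp Real.measurable_exp).div Real.measurable_exp

/-- The L-series of `Λ` minus its pole at `1` extends continuously to `1 ≤ re s`. -/
theorem exists_continuousOn_LSeries_vonMangoldt : ∃ F : ℂ → ℂ, ContinuousOn F {s | 1 ≤ s.re} ∧
    ∀ s : ℂ, 1 < s.re →
      LSeries (fun n => (ArithmeticFunction.vonMangoldt n : ℂ)) s = F s + 1 / (s - 1) := by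
  refine ⟨ArithmeticFunction.vonMangoldt.LFunctionResidueClassAux (q := 1) 1,
    ArithmeticFunction.vonMangoldt.continuousOn_LFunctionResidueClassAux 1, fun s hs => ?_⟩
  rw [ArithmeticFunction.vonMangoldt.eqOn_LFunctionResidueClassAux isUnit_one hs]
  have h (n : ℕ) : ArithmeticFunction.vonMangoldt.residueClass (1 : ZMod 1) n =
      ArithmeticFunction.vonMangoldt n := by
    rw [ArithmeticFunction.vonMangoldt.residueClass, indicator_of_mem]
    exact Subsingleton.elim _ _
  simp [h]

/-- The prime number theorem for the Chebyshev function `ψ`. -/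
theorem tendsto_psi_div_self : Tendsto (fun x => Chebyshev.psi x / x) atTop (𝓝 1) := by
  obtain ⟨F, hF, hFL⟩ := exists_continuousOn_LSeries_vonMangoldt
  have h : Tendsto (fun t => Chebyshev.psi (Real.exp t) / Real.exp t) atTop (𝓝 1) := by
    refine tendsto_one_of_laplace_continuousOn measurable_psi_exp_div_exp
      (fun t _ => psi_exp_div_exp_nonneg t) (fun t _ => psi_exp_div_exp_le t) ?_
      (G := fun s => (F (s + 1) - 1) / (s + 1)) ?_ ?_
    · intro s t _ hst
      have h1 : Real.exp (-(t - s)) = Real.exp s / Real.exp t := by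
        rw [← Real.exp_sub]; congr 1; ring
      rw [h1, div_mul_div_cancel₀ (Real.exp_pos s).ne']
      have := Chebyshev.psi_mono (Real.exp_le_exp.2 hst)
      gcongr
    · refine ContinuousOn.div ((hF.comp (by fun_prop) fun s hs => ?_).sub continuousOn_const)
        (by fun_prop) fun s hs h => ?_
      · simpa using hs
      · have := congrArg re h
        simp only [add_re, one_re, zero_re] at this
        have hs' : 0 ≤ s.re := hs
        linarith
    · intro s hs
      have hs0 : s ≠ 0 := by rintro rfl; simp at hs
      have hs1 : s + 1 ≠ 0 := by
        intro h
        have := congrArg re h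
        simp only [add_re, one_re, zero_re] at this
        linarith
      have hi : IntegrableOn (fun t : ℝ => cexp (-s * t)) (Ioi 0) :=
        integrableOn_exp_mul_complex_Ioi (by simpa using hs) 0
      have h1 : Integrable (fun t : ℝ => ((Chebyshev.psi (Real.exp t) / Real.exp t : ℝ) : ℂ) *
          cexp (-s * t)) (volume.restrict (Ioi 0)) :=
        hi.bdd_mul (c := Real.log 4 + 4)
          (measurable_ofReal.comp measurable_psi_exp_div_exp).aestronglyMeasurable
          (ae_of_all _ fun t => by
            rw [norm_real, Real.norm_of_nonneg (psi_exp_div_exp_nonneg t)]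
            exact psi_exp_div_exp_le t)
      simp_rw [ofReal_sub, sub_mul, ofReal_one, one_mul]
      rw [integral_sub h1 hi, integral_psi_exp_mul_cexp hs, hFL _ (by simpa using hs),
        integral_exp_mul_complex_Ioi (by simpa using hs)]
      simp
      field_simp
      ring
  refine (h.comp Real.tendsto_log_atTop).congr' ?_
  filter_upwards [eventually_gt_atTop 0] with x hx
  simp [Real.exp_log hx]

/-- The prime number theorem for the Chebyshev function `θ`. -/
theorem tendsto_theta_div_self : Tendsto (fun x => Chebyshev.theta x / x) atTop (𝓝 1) := by
  have h1 : (fun x => Chebyshev.psi x - Chebyshev.theta x) =o[atTop] fun x : ℝ => x := by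
    refine Chebyshev.isBigO_psi_sub_theta_sqrt.trans_isLittleO ?_
    refine Asymptotics.isLittleO_of_tendsto (fun x hx => by simp [hx]) ?_
    simp_rw [Real.sqrt_div_self]
    exact tendsto_inv_atTop_zero.comp Real.tendsto_sqrt_atTop
  have h2 := tendsto_psi_div_self.sub h1.tendsto_div_nhds_zero
  rw [sub_zero] at h2
  refine h2.congr fun x => ?_
  ring

theorem log_mul_primorial (p : ℕ) (hp : p ≠ 0) :
    Real.log (p * primorial p) = Real.log p + Chebyshev.theta p := by
  rw [Real.log_mul (by exact_mod_cast hp) (by exact_mod_cast (primorial_pos p).ne'),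
    Chebyshev.theta_eq_log_primorial, Nat.floor_natCast]

theorem mul_primorial_le_iff {p : ℕ} (hp : p ≠ 0) {B : ℝ} (hB : 0 < B) :
    (p : ℝ) * primorial p ≤ B ↔ Real.log p + Chebyshev.theta p ≤ Real.log B := by
  have : 0 < (p : ℝ) * primorial p := by
    have := primorial_pos p
    positivity
  rw [← log_mul_primorial p hp, Real.log_le_log_iff this hB]

theorem exists_prime_of_theta_lt {x y : ℝ} (hy : 0 ≤ y)
    (h : Chebyshev.theta x < Chebyshev.theta y) : ∃ p : ℕ, p.Prime ∧ x < p ∧ (p : ℝ) ≤ y := by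
  by_contra! hne
  refine h.not_ge (Finset.sum_le_sum_of_subset_of_nonneg (fun p hp => ?_) fun p hp _ => ?_)
  · simp only [Finset.mem_filter, Finset.mem_Ioc] at hp ⊢
    refine ⟨⟨hp.1.1, Nat.le_floor (not_lt.1 fun hx => ?_)⟩, hp.2⟩
    exact (hne p hp.2 hx).not_ge ((Nat.le_floor_iff hy).1 hp.1.2)
  · exact Real.log_natCast_nonneg p

theorem bddAbove_pB_set (B : ℝ) :
    BddAbove {p : ℕ | p.Prime ∧ (p : ℝ) * (primorial p : ℝ) ≤ B} := by
  refine ⟨⌊B⌋₊, fun p hp => Nat.le_floor (le_trans ?_ hp.2)⟩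
  exact le_mul_of_one_le_right (Nat.cast_nonneg p) (by exact_mod_cast primorial_pos p)

/-- `p_B` is asymptotic to `log B` as `B → ∞`: `p_B / log B → 1`. -/
theorem pB_asymptotic_log :
    Filter.Tendsto (fun B : ℝ => (pB B : ℝ) / Real.log B) Filter.atTop (nhds 1) := by
  have hlog : Tendsto (fun x : ℝ => Real.log x / x) atTop (𝓝 0) :=
    Real.isLittleO_log_id_atTop.tendsto_div_nhds_zero
  have hh : Tendsto (fun x : ℝ => (Real.log x + Chebyshev.theta x) / x) atTop (𝓝 1) := by
    simpa [add_div] using hlog.add tendsto_theta_div_self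
  have hlt (c d : ℝ) (f : ℝ → ℝ) (hf : Tendsto (fun x => f x / x) atTop (𝓝 1)) (hc : 0 < c)
      (hcd : c < d) : ∀ᶠ L in atTop, f (c * L) < d * L := by
    have t : Tendsto (fun L : ℝ => c * L) atTop atTop := tendsto_id.const_mul_atTop hc
    have := t.eventually (hf.eventually_lt_const (show 1 < d / c by rwa [one_lt_div hc]))
    filter_upwards [this, eventually_gt_atTop 0] with L h hL
    rw [div_lt_div_iff₀ (by positivity) hc] at h
    nlinarith
  have hgt (c d : ℝ) (f : ℝ → ℝ) (hf : Tendsto (fun x => f x / x) atTop (𝓝 1)) (hc : 0 < c)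
      (hcd : d < c) : ∀ᶠ L in atTop, d * L < f (c * L) := by
    have t : Tendsto (fun L : ℝ => c * L) atTop atTop := tendsto_id.const_mul_atTop hc
    have := t.eventually (hf.eventually_const_lt (show d / c < 1 by rwa [div_lt_one hc]))
    filter_upwards [this, eventually_gt_atTop 0] with L h hL
    rw [div_lt_div_iff₀ hc (by positivity)] at h
    nlinarith
  have hlower (c : ℝ) (hc : 0 < c) (hc1 : c < 1) : ∀ᶠ B in atTop,
      c * Real.log B < pB B ∧ ∃ p : ℕ, p.Prime ∧ (p : ℝ) * (primorial p : ℝ) ≤ B := by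
    obtain ⟨d, hcd, hd1⟩ := exists_between hc1
    obtain ⟨e, hce, hed⟩ := exists_between hcd
    filter_upwards [Real.tendsto_log_atTop.eventually (hlt c e _ tendsto_theta_div_self hc hce),
      Real.tendsto_log_atTop.eventually (hgt d e _ tendsto_theta_div_self (hc.trans hcd) hed),
      Real.tendsto_log_atTop.eventually (hlt d 1 _ hh (hc.trans hcd) hd1),
      eventually_gt_atTop 1] with B h1 h2 h3 hB
    have hL := Real.log_pos hB
    obtain ⟨p, hp, hcp, hpd⟩ := exists_prime_of_theta_lt
      (mul_nonneg (hc.trans hcd).le hL.le) (h1.trans h2)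
    have hpB : (p : ℝ) * (primorial p : ℝ) ≤ B := by
      rw [mul_primorial_le_iff hp.ne_zero (one_pos.trans hB)]
      have := Chebyshev.theta_mono hpd
      have := Real.log_le_log (by exact_mod_cast hp.pos) hpd
      linarith
    refine ⟨hcp.trans_le ?_, p, hp, hpB⟩
    exact Nat.cast_le.2 (le_csSup (bddAbove_pB_set B) ⟨hp, hpB⟩)
  refine tendsto_order.2 ⟨fun r hr => ?_, fun r hr => ?_⟩
  · obtain ⟨c, hc, hc1⟩ := exists_between (max_lt hr one_pos)
    filter_upwards [hlower c ((le_max_right _ _).trans_lt hc) hc1, eventually_gt_atTop 1]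
      with B h hB
    rw [lt_div_iff₀ (Real.log_pos hB)]
    have := Real.log_pos hB
    nlinarith [h.1, (le_max_left _ _).trans_lt hc]
  · filter_upwards [hlower (1 / 2) (by norm_num) (by norm_num),
      Real.tendsto_log_atTop.eventually (hgt r 1 _ hh (one_pos.trans hr) hr),
      eventually_gt_atTop 1] with B h h1 hB
    have hL := Real.log_pos hB
    rw [div_lt_iff₀ hL]
    by_contra! hle
    obtain ⟨hp, hpB⟩ := Nat.sSup_mem (show
      {p : ℕ | p.Prime ∧ (p : ℝ) * (primorial p : ℝ) ≤ B}.Nonempty from h.2) (bddAbove_pB_set B)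
    change (pB B).Prime at hp
    change (pB B : ℝ) * (primorial (pB B) : ℝ) ≤ B at hpB
    rw [mul_primorial_le_iff hp.ne_zero (one_pos.trans hB)] at hpB
    have := Chebyshev.theta_mono hle
    have := Real.log_le_log (by positivity) hle
    linarith
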